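/- Fix an integer g with 0 ≤ g ≤ 2. For each n ≥ 1 with 3g−3+n ≥ 0, let C_n be a function from partitions to ℚ that vanishes on every partition λ unless all parts of λ lie in {2,…,n} and |λ| ≤ 3g−3+n, and define A_n := Σ_λ C_n(λ)·e_λ(x_1,…,x_n)·e_1(x_1,…,x_n)^{3g−3+n−|λ|} in ℚ[x_1,…,x_n]. Suppose the string equation holds: for every such n, A_{n+1}(x_1,…,x_n,0) = e_1(x_1,…,x_n)·A_n(x_1,…,x_n). Then C_n(λ) = 0 for every n and every partition λ with ℓ(λ) > g (with all parts in {2,…,n} and |λ| ≤ 3g−3+n). In other words, the string equation alone implies the paper's main conjecture (at most g parts ≥ 2 occur) for genus g ≤ 2. -/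

import Mathlib

open MvPolynomial

/-- `e_λ = ∏_{a ∈ λ} e_a`, the product of elementary symmetric polynomials
indexed by the parts of the partition `p` (a multiset of positive integers). -/
noncomputable def esymmProd (n : ℕ) (p : Multiset ℕ) : MvPolynomial (Fin n) ℚ :=
  (p.map (esymm (Fin n) ℚ)).prod

/-- The amplitude `A_n = Σ_λ C(λ) · e_λ · e_1 ^ (3g-3+n-|λ|)` in `ℚ[x_1,…,x_n]`. -/
noncomputable def amplitude (g n : ℕ) (C : Multiset ℕ → ℚ) : MvPolynomial (Fin n) ℚ :=
  ∑ᶠ p : Multiset ℕ,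
    C p • (esymmProd n p * (esymm (Fin n) ℚ 1) ^ (3 * g + n - 3 - p.sum))

/-- Setting the last variable `x_{n+1}` to zero. -/
noncomputable def setLastZero (n : ℕ) :
    MvPolynomial (Fin (n + 1)) ℚ →ₐ[ℚ] MvPolynomial (Fin n) ℚ :=
  aeval (Fin.lastCases 0 X)

/-- Partitions of size at most `N` with all parts in `{2,…,n}`. -/
def boundedPartitions (n N : ℕ) : Set (Multiset ℕ) :=
  {p | (∀ a ∈ p, 2 ≤ a ∧ a ≤ n) ∧ p.sum ≤ N}

theorem two_mul_card_le_sum {p : Multiset ℕ} (hp : ∀ a ∈ p, 2 ≤ a) :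
    2 * Multiset.card p ≤ p.sum := by
  simpa [mul_comm] using Multiset.card_nsmul_le_sum hp

theorem finite_boundedPartitions (n N : ℕ) : (boundedPartitions n N).Finite := by
  refine (Set.finite_Iic (N • (Multiset.range (n + 1)))).subset fun p hp => ?_
  rw [Set.mem_Iic, Multiset.le_iff_count]
  intro a
  by_cases ha : a ∈ p
  · have hcount : (Multiset.range (n + 1)).count a = 1 :=
      Multiset.count_eq_one_of_mem (Multiset.nodup_range _)
        (Multiset.mem_range.2 (Nat.lt_succ_of_le (hp.1 a ha).2))
    have hcard := two_mul_card_le_sum fun a ha => (hp.1 a ha).1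
    have hle := Multiset.count_le_card a p
    have hsum := hp.2
    rw [Multiset.count_nsmul, hcount]
    omega
  · simp [Multiset.count_eq_zero_of_notMem ha]

theorem setLastZero_esymm (n k : ℕ) :
    setLastZero n (esymm (Fin (n + 1)) ℚ k) = esymm (Fin n) ℚ k := by
  rw [setLastZero, aeval_esymm_eq_multiset_esymm, esymm_eq_multiset_esymm,
    Fin.univ_castSuccEmb]
  simp only [Finset.cons_val, Multiset.map_cons, Finset.map_val, Multiset.map_map,
    Function.comp_def, Fin.lastCases_last, Fin.coe_castSuccEmb, Fin.lastCases_castSucc]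
  cases k <;> simp only [Multiset.esymm, Multiset.powersetCard_zero_left,
    Multiset.powersetCard_cons, Multiset.map_add, Multiset.sum_add, Multiset.map_map,
    Function.comp_def, Multiset.prod_cons, zero_mul, Multiset.map_const',
    Multiset.sum_replicate, smul_zero, add_zero]

theorem setLastZero_esymmProd (n : ℕ) (p : Multiset ℕ) :
    setLastZero n (esymmProd (n + 1) p) = esymmProd n p := by
  simp only [esymmProd, map_multiset_prod, Multiset.map_map, Function.comp_def,
    setLastZero_esymm]

theorem esymm_eq_zero_of_lt {n k : ℕ} (h : n < k) : esymm (Fin n) ℚ k = 0 := by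
  rw [esymm, Finset.powersetCard_eq_empty.2 (by simpa using h), Finset.sum_empty]

theorem aeval_monomial_toFinsupp (n : ℕ) (r : Multiset (Fin n)) :
    aeval (fun i : Fin n => esymm (Fin n) ℚ (i + 1)) (monomial (Multiset.toFinsupp r) (1 : ℚ)) =
      esymmProd n (r.map fun i : Fin n => (i : ℕ) + 1) := by
  induction r using Multiset.induction_on with
  | empty => simp [esymmProd]
  | cons i r ih =>
    rw [← Multiset.singleton_add, map_add, ← one_mul (1 : ℚ), ← monomial_mul, map_mul, ih,
      Multiset.toFinsupp_singleton, aeval_monomial]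
    simp [esymmProd]

theorem aeval_esymm_injective (n : ℕ) :
    Function.Injective (aeval (R := ℚ) fun i : Fin n => esymm (Fin n) ℚ (i + 1)) := by
  intro p q h
  apply esymmAlgHom_fin_injective ℚ (le_refl n)
  apply Subtype.ext
  rwa [esymmAlgHom_apply, esymmAlgHom_apply]

theorem linearIndependent_esymmProd_map (n : ℕ) :
    LinearIndependent ℚ fun r : Multiset (Fin n) =>
      esymmProd n (r.map fun i : Fin n => (i : ℕ) + 1) := by
  have hbasis := (basisMonomials (Fin n) ℚ).linearIndependent.map_injOn
    (aeval (R := ℚ) fun i : Fin n => esymm (Fin n) ℚ (i + 1)).toLinearMap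
    (aeval_esymm_injective n).injOn
  have hcomp := hbasis.comp _ (Multiset.toFinsupp (α := Fin n)).injective
  simpa only [Function.comp_def, coe_basisMonomials, AlgHom.toLinearMap_apply,
    aeval_monomial_toFinsupp] using hcomp

theorem exists_map_val_add_one_eq {n : ℕ} {q : Multiset ℕ} (hq : ∀ a ∈ q, 1 ≤ a ∧ a ≤ n) :
    ∃ r : Multiset (Fin n), (r.map fun i : Fin n => (i : ℕ) + 1) = q := by
  have : CanLift ℕ (Fin n) (fun i => (i : ℕ) + 1) (fun a => 1 ≤ a ∧ a ≤ n) :=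
    ⟨fun a ha => ⟨⟨a - 1, by omega⟩, Nat.sub_add_cancel ha.1⟩⟩
  exact CanLift.prf (β := Multiset (Fin n)) q hq

theorem linearIndepOn_esymmProd (n : ℕ) :
    LinearIndepOn ℚ (esymmProd n) {q | ∀ a ∈ q, 1 ≤ a ∧ a ≤ n} := by
  have hinj : Function.Injective (Multiset.map fun i : Fin n => (i : ℕ) + 1) :=
    Multiset.map_injective fun i j h => Fin.ext (Nat.succ_injective h)
  have hrange := (linearIndepOn_range_iff hinj (esymmProd n)).2
    (linearIndependent_esymmProd_map n)
  exact hrange.mono fun q hq => exists_map_val_add_one_eq hq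

theorem linearIndepOn_esymmProd_mul_pow {n : ℕ} (hn : 1 ≤ n) (N : ℕ) :
    LinearIndepOn ℚ (fun p => esymmProd n p * esymm (Fin n) ℚ 1 ^ (N - p.sum))
      (boundedPartitions n N) := by
  have hinj : Set.InjOn (fun p : Multiset ℕ => p + Multiset.replicate (N - p.sum) 1)
      (boundedPartitions n N) := by
    have hfilter : ∀ p ∈ boundedPartitions n N,
        (p + Multiset.replicate (N - p.sum) 1).filter (2 ≤ ·) = p := by
      intro p hp
      rw [Multiset.filter_add, Multiset.filter_eq_self.2 fun a ha => (hp.1 a ha).1,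
        Multiset.filter_eq_nil.2, add_zero]
      intro a ha
      rw [Multiset.eq_of_mem_replicate ha]
      norm_num
    intro p hp q hq hpq
    rw [← hfilter p hp, ← hfilter q hq]
    exact congrArg _ hpq
  have himage := (linearIndepOn_esymmProd n).mono
    (t := (fun p : Multiset ℕ => p + Multiset.replicate (N - p.sum) 1) ''
      boundedPartitions n N) ?_
  · simpa [Function.comp_def, esymmProd] using himage.comp_of_image hinj
  · rintro _ ⟨p, hp, rfl⟩ a ha
    rcases Multiset.mem_add.1 ha with ha | ha
    · exact ⟨by have := (hp.1 a ha).1; omega, (hp.1 a ha).2⟩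
    · rw [Multiset.eq_of_mem_replicate ha]
      exact ⟨le_rfl, hn⟩

theorem amplitude_eq_sum {g n N : ℕ} {C : Multiset ℕ → ℚ} {F : Finset (Multiset ℕ)}
    (hC : ∀ p ∉ F, C p = 0) (hN : 3 * g + n - 3 = N) :
    amplitude g n C =
      ∑ p ∈ F, C p • (esymmProd n p * esymm (Fin n) ℚ 1 ^ (N - p.sum)) := by
  subst hN
  refine finsum_eq_sum_of_support_subset _ fun p hp => ?_
  by_contra hpF
  exact hp (by simp [hC p hpF])

/-- The string equation makes the coefficients independent of the number of variables. -/
theorem coeff_succ_eq_of_string (g n : ℕ) (hn : 1 ≤ n) (hgn : 3 ≤ 3 * g + n)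
    (C C' : Multiset ℕ → ℚ)
    (hC : ∀ p : Multiset ℕ,
      ¬ ((∀ a ∈ p, 2 ≤ a ∧ a ≤ n) ∧ p.sum + 3 ≤ 3 * g + n) → C p = 0)
    (hC' : ∀ p : Multiset ℕ,
      ¬ ((∀ a ∈ p, 2 ≤ a ∧ a ≤ n + 1) ∧ p.sum + 3 ≤ 3 * g + (n + 1)) → C' p = 0)
    (hstring : setLastZero n (amplitude g (n + 1) C') = esymm (Fin n) ℚ 1 * amplitude g n C)
    (p : Multiset ℕ) (hp : p ∈ boundedPartitions n (3 * g + n - 2)) :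
    C' p = C p := by
  obtain ⟨N, hN⟩ : ∃ N, 3 * g + n = N + 3 := ⟨3 * g + n - 3, by omega⟩
  have hN' : 3 * g + n - 2 = N + 1 := by omega
  rw [hN'] at hp
  set G := (finite_boundedPartitions n (N + 1)).toFinset with hG
  set F := (finite_boundedPartitions (n + 1) (N + 1)).toFinset with hF
  have hGF : G ⊆ F := by
    intro q hq
    simp only [hG, hF, Set.Finite.mem_toFinset] at hq ⊢
    exact ⟨fun a ha => ⟨(hq.1 a ha).1, (hq.1 a ha).2.trans n.le_succ⟩, hq.2⟩
  rw [amplitude_eq_sum (F := F) (N := N + 1) _ (by omega),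
    amplitude_eq_sum (F := G) (N := N) _ (by omega), map_sum, Finset.mul_sum] at hstring
  · simp only [map_smul, map_mul, map_pow, setLastZero_esymmProd, setLastZero_esymm] at hstring
    rw [← Finset.sum_subset hGF] at hstring
    · have hzero : ∑ q ∈ G, (C' q - C q) •
          (esymmProd n q * esymm (Fin n) ℚ 1 ^ (N + 1 - q.sum)) = 0 := by
        simp only [sub_smul, Finset.sum_sub_distrib]
        rw [hstring, sub_eq_zero]
        refine Finset.sum_congr rfl fun q _ => ?_
        by_cases hq : q.sum ≤ N
        · rw [Nat.succ_sub hq, pow_succ, mul_smul_comm]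
          congr 1
          ring
        · rw [hC q fun h => hq (by omega)]
          simp
      exact sub_eq_zero.1 <| linearIndepOn_iff'.1 (linearIndepOn_esymmProd_mul_pow hn (N + 1))
        G _ (by simp [hG]) hzero p (by simpa [hG] using hp)
    · intro q hqF hqG
      simp only [hG, hF, Set.Finite.mem_toFinset] at hqF hqG
      have hmem : ∃ a ∈ q, n < a := by
        by_contra! h
        exact hqG ⟨fun a ha => ⟨(hqF.1 a ha).1, h a ha⟩, hqF.2⟩
      obtain ⟨a, ha, hna⟩ := hmem
      have hprod : esymmProd n q = 0 :=
        Multiset.prod_eq_zero (Multiset.mem_map.2 ⟨a, ha, esymm_eq_zero_of_lt hna⟩)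
      simp [hprod]
  · intro q hq
    refine hC q fun h => hq ?_
    simp only [hG, Set.Finite.mem_toFinset]
    exact ⟨h.1, by omega⟩
  · intro q hq
    refine hC' q fun h => hq ?_
    simp only [hF, Set.Finite.mem_toFinset]
    exact ⟨h.1, by omega⟩


/-- For `g ≤ 2`, the string equation alone implies the main conjecture:
`C_n(λ) = 0` whenever `λ` has more than `g` parts (all parts in `{2,…,n}`
and `|λ| ≤ 3g-3+n`). -/
theorem string_implies_conjecture_low_genus (g : ℕ) (hg : g ≤ 2)
    (C : ℕ → Multiset ℕ → ℚ)
    (hvan : ∀ n, 1 ≤ n → 3 ≤ 3 * g + n → ∀ p : Multiset ℕ,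
      ¬ ((∀ a ∈ p, 2 ≤ a ∧ a ≤ n) ∧ p.sum + 3 ≤ 3 * g + n) → C n p = 0)
    (hstring : ∀ n, 1 ≤ n → 3 ≤ 3 * g + n →
      setLastZero n (amplitude g (n + 1) (C (n + 1)))
        = esymm (Fin n) ℚ 1 * amplitude g n (C n)) :
    ∀ n, 1 ≤ n → 3 ≤ 3 * g + n → ∀ p : Multiset ℕ,
      (∀ a ∈ p, 2 ≤ a ∧ a ≤ n) → p.sum + 3 ≤ 3 * g + n →
      g < Multiset.card p →
      C n p = 0 := by
  intro n
  induction n with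
  | zero => intro h; omega
  | succ n ih =>
    intro _ hgn p hp hsum hcard
    have hne : p ≠ 0 := by rintro rfl; simp at hcard
    have hcs := two_mul_card_le_sum fun a ha => (hp a ha).1
    obtain ⟨b, hb⟩ := Multiset.exists_mem_of_ne_zero hne
    have hb2 := hp b hb
    have hn : 1 ≤ n := by omega
    have hgn' : 3 ≤ 3 * g + n := by omega
    by_cases hlast : n + 1 ∈ p
    · obtain ⟨q, rfl⟩ := Multiset.exists_cons_of_mem hlast
      have hq := two_mul_card_le_sum fun a ha => (hp a (Multiset.mem_cons_of_mem ha)).1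
      simp only [Multiset.sum_cons, Multiset.card_cons] at hsum hcard
      omega
    · have hp' : ∀ a ∈ p, 2 ≤ a ∧ a ≤ n := fun a ha =>
        ⟨(hp a ha).1, Nat.le_of_lt_succ <|
          lt_of_le_of_ne (hp a ha).2 fun h => hlast (by simpa [h] using ha)⟩
      rw [coeff_succ_eq_of_string g n hn hgn' (C n) (C (n + 1)) (hvan n hn hgn')
        (hvan (n + 1) (by omega) (by omega)) (hstring n hn hgn') p ⟨hp', by omega⟩]
      by_cases hs : p.sum + 3 ≤ 3 * g + n
      · exact ih hn hgn' p hp' hs hcard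
      · exact hvan n hn hgn' p fun h => hs h.2
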